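/- Let G be a group generated by a finite set X, let Q, R ≤ G be subgroups, set S = Q ∩ R, and let 𝒫 be a finite collection of subgroups of G. Suppose Q and R are separable in G and, for each P ∈ 𝒫, the product PS is separable in G. Then for any constants B, C ≥ 0 there exists a finite index subgroup L ≤_f G with S ⊆ L such that for arbitrary subgroups Q' ≤ Q ∩ L and R' ≤ R ∩ L: every element of Q⟨Q', R'⟩Q ∖ Q and every element of R⟨Q', R'⟩R ∖ R has word length at least B with respect to X; and for every P ∈ 𝒫, every element of (PQ' ∪ PR') ∖ PS has word length at least C with respect to X. -/

import Mathlib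

open Pointwise

/-- A subset `Z` of a group `G` is separable (closed in the profinite topology on `G`):
for every `g ∉ Z` there is a finite index normal subgroup `N` of `G` with `g ∉ ZN`. -/
def SepSubset {G : Type*} [Group G] (Z : Set G) : Prop :=
  ∀ g ∉ Z, ∃ N : Subgroup G, N.Normal ∧ N.FiniteIndex ∧ g ∉ Z * (N : Set G)

/-- The word length of `g` with respect to a generating set `X`: the least `n` such that
`g` is a product of `n` elements of `X ∪ X⁻¹`. -/
noncomputable def wordLength {G : Type*} [Group G] (X : Set G) (g : G) : ℕ :=
  sInf {n : ℕ | ∃ l : List G, l.length = n ∧ (∀ x ∈ l, x ∈ X ∪ X⁻¹) ∧ l.prod = g}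

/-- A finite index normal subgroup separates finitely many elements from finitely many
separable sets simultaneously. -/
theorem exists_normal_finiteIndex_separating {G : Type*} [Group G] {𝒵 : Set (Set G)}
    (h𝒵 : 𝒵.Finite) (hsep : ∀ Z ∈ 𝒵, SepSubset Z) {F : Set G} (hF : F.Finite) :
    ∃ N : Subgroup G, N.Normal ∧ N.FiniteIndex ∧
      ∀ Z ∈ 𝒵, ∀ g ∈ F, g ∈ Z * (N : Set G) → g ∈ Z := by
  have : Finite 𝒵 := h𝒵
  have : Finite F := hF
  have key : ∀ p : 𝒵 × F, ∃ N : Subgroup G, N.Normal ∧ N.FiniteIndex ∧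
      ((p.2 : G) ∈ (p.1 : Set G) * (N : Set G) → (p.2 : G) ∈ (p.1 : Set G)) := by
    rintro ⟨⟨Z, hZ⟩, ⟨g, _⟩⟩
    by_cases hg : g ∈ Z
    · exact ⟨⊤, inferInstance, inferInstance, fun _ => hg⟩
    · obtain ⟨N, hN, hfin, hgN⟩ := hsep Z hZ g hg
      exact ⟨N, hN, hfin, fun h => absurd h hgN⟩
  choose N hnormal hfin hN using key
  refine ⟨⨅ p, N p, Subgroup.normal_iInf_normal hnormal, Subgroup.finiteIndex_iInf hfin, ?_⟩
  intro Z hZ g hg hmem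
  exact hN (⟨Z, hZ⟩, ⟨g, hg⟩)
    (Set.mul_subset_mul_left (SetLike.coe_subset_coe.mpr (iInf_le N _)) hmem)

/-- Balls of the word length of a finite generating set are finite. -/
theorem finite_setOf_wordLength_lt {G : Type*} [Group G] {X : Set G} (hXfin : X.Finite)
    (hXgen : Subgroup.closure X = ⊤) (B : ℝ) : {g : G | (wordLength X g : ℝ) < B}.Finite := by
  have hpow : ∀ n : ℕ, ((X ∪ X⁻¹) ^ n).Finite := by
    intro n
    induction n with
    | zero => simp
    | succ n ih => rw [pow_succ]; exact ih.mul (hXfin.union hXfin.inv)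
  have hprod : ∀ l : List G, (∀ x ∈ l, x ∈ X ∪ X⁻¹) → l.prod ∈ (X ∪ X⁻¹) ^ l.length := by
    intro l
    induction l with
    | nil => simp
    | cons a l ih =>
      intro h
      rw [List.prod_cons, List.length_cons, pow_succ']
      exact Set.mul_mem_mul (h a (by simp)) (ih fun x hx => h x (by simp [hx]))
  refine ((Set.finite_lt_nat ⌈B⌉₊).biUnion fun n _ => hpow n).subset fun g hg => ?_
  have hne : {n : ℕ | ∃ l : List G, l.length = n ∧
      (∀ x ∈ l, x ∈ X ∪ X⁻¹) ∧ l.prod = g}.Nonempty := by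
    have hgcl : g ∈ Submonoid.closure (X ∪ X⁻¹) := by
      rw [← Subgroup.closure_toSubmonoid, hXgen]
      exact Subgroup.mem_top g
    obtain ⟨l, hl, hlg⟩ := Submonoid.exists_list_of_mem_closure hgcl
    exact ⟨l.length, l, rfl, hl, hlg⟩
  obtain ⟨l, hlen, hl, hlg⟩ := Nat.sInf_mem hne
  have hlen' : l.length = wordLength X g := hlen
  refine Set.mem_biUnion (x := wordLength X g) (Nat.lt_ceil.mpr hg) ?_
  rw [← hlen', ← hlg]
  exact hprod l hl

/-- If `S ≤ H`, `N` is normal and `K ≤ SN`, then `HKH ⊆ HN`. -/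
theorem mul_sup_mul_subset {G : Type*} [Group G] {H S N K : Subgroup G} [N.Normal]
    (hS : S ≤ H) (hK : K ≤ S ⊔ N) :
    (H : Set G) * (K : Set G) * (H : Set G) ⊆ (H : Set G) * (N : Set G) := by
  rw [← Subgroup.mul_normal H N]
  rintro _ ⟨_, ⟨a, ha, k, hk, rfl⟩, b, hb, rfl⟩
  have hle : S ⊔ N ≤ H ⊔ N := sup_le_sup_right hS N
  exact mul_mem (mul_mem (Subgroup.mem_sup_left ha) (hle (hK hk))) (Subgroup.mem_sup_left hb)

/-- Proposition 7.1: separability of `Q`, `R` and of the double cosets `PS` yields a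
finite index subgroup `L ≤_f G` realising conditions (C2) and (C3). -/
theorem stmt_13 {G : Type*} [Group G] (X : Set G) (hXfin : X.Finite)
    (hXgen : Subgroup.closure X = ⊤) (Q R : Subgroup G) (Ps : Finset (Subgroup G))
    (hQ : SepSubset (Q : Set G)) (hR : SepSubset (R : Set G))
    (hPS : ∀ P ∈ Ps, SepSubset ((P : Set G) * ((Q ⊓ R : Subgroup G) : Set G)))
    (B C : ℝ) (hB : 0 ≤ B) (hC : 0 ≤ C) :
    ∃ L : Subgroup G, L.FiniteIndex ∧ Q ⊓ R ≤ L ∧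
      ∀ Q' R' : Subgroup G, Q' ≤ Q ⊓ L → R' ≤ R ⊓ L →
        -- (C2)
        (∀ g ∈ ((Q : Set G) * (↑(Q' ⊔ R') : Set G) * (Q : Set G)) \ (Q : Set G),
          B ≤ (wordLength X g : ℝ)) ∧
        (∀ g ∈ ((R : Set G) * (↑(Q' ⊔ R') : Set G) * (R : Set G)) \ (R : Set G),
          B ≤ (wordLength X g : ℝ)) ∧
        -- (C3)
        (∀ P ∈ Ps, ∀ g ∈ (((P : Set G) * (Q' : Set G)) ∪ ((P : Set G) * (R' : Set G))) \
            ((P : Set G) * ((Q ⊓ R : Subgroup G) : Set G)),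
          C ≤ (wordLength X g : ℝ)) := by
  set S : Subgroup G := Q ⊓ R
  obtain ⟨N, hNn, hNf, hN⟩ := exists_normal_finiteIndex_separating
    (𝒵 := {(Q : Set G), (R : Set G)} ∪ (fun P : Subgroup G => (P : Set G) * (S : Set G)) '' Ps)
    ((Set.toFinite _).union (Ps.finite_toSet.image _))
    (by
      rintro Z ((rfl | rfl) | ⟨P, hP, rfl⟩)
      exacts [hQ, hR, hPS P hP])
    (finite_setOf_wordLength_lt hXfin hXgen (max B C))
  have hlen : ∀ Z : Set G, (Z ∈ ({(Q : Set G), (R : Set G)} ∪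
      (fun P : Subgroup G => (P : Set G) * (S : Set G)) '' Ps : Set (Set G))) →
      ∀ g ∈ Z * (N : Set G), g ∉ Z → max B C ≤ (wordLength X g : ℝ) :=
    fun Z hZ g hgN hgZ => not_lt.mp fun hlt => hgZ (hN Z hZ g hlt hgN)
  refine ⟨S ⊔ N, Subgroup.finiteIndex_of_le le_sup_right, le_sup_left, fun Q' R' hQ' hR' => ?_⟩
  have hQL : Q' ≤ S ⊔ N := hQ'.trans inf_le_right
  have hRL : R' ≤ S ⊔ N := hR'.trans inf_le_right
  refine ⟨fun g hg => ?_, fun g hg => ?_, fun P hP g hg => ?_⟩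
  · exact (le_max_left B C).trans (hlen Q (by simp) g
      (mul_sup_mul_subset inf_le_left (sup_le hQL hRL) hg.1) hg.2)
  · exact (le_max_left B C).trans (hlen R (by simp) g
      (mul_sup_mul_subset inf_le_right (sup_le hQL hRL) hg.1) hg.2)
  · refine (le_max_right B C).trans (hlen _ (Or.inr ⟨P, hP, rfl⟩) g ?_ hg.2)
    change g ∈ (P : Set G) * (S : Set G) * (N : Set G)
    rw [mul_assoc, ← Subgroup.mul_normal]
    rcases hg.1 with h | h
    · exact Set.mul_subset_mul_left (SetLike.coe_subset_coe.mpr hQL) h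
    · exact Set.mul_subset_mul_left (SetLike.coe_subset_coe.mpr hRL) h
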